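/- Let d ≥ 1 be an integer, 1 ≤ p < ∞, 1 ≤ v < ∞ with d > 2v. Suppose there is a constant c > 0 such that for every n ∈ ℕ the prior concentrations satisfy α_{j,b_n} ≥ 0 for all j ∈ {1,…,b_n}^d and Σ_{j ∈ {1,…,b_n}^d} α_{j,b_n} ≤ c·n^{1−v/d}. Then there exist a constant C > 0 (depending only on d, v, p, c) and N ∈ ℕ such that for every n ≥ N, every Borel probability measure P₀ on [0,1)^d, and Y₁,…,Y_n i.i.d. with law P₀, the expectation over the sample satisfies E[W_v(P₀, P̄_n)] ≤ C·n^{-1/d}. -/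

import Mathlib

open MeasureTheory Filter
open scoped ENNReal NNReal Classical BigOperators

noncomputable section

/-- ℓ^p distance on ℝ^d. -/
def lpDist (p : ℝ) {d : ℕ} (x y : Fin d → ℝ) : ℝ :=
  (∑ l, |x l - y l| ^ p) ^ (1 / p)

/-- Wasserstein-v distance with respect to the ℓ^p metric, via couplings. -/
def wassersteinLp (p v : ℝ) {d : ℕ} (μ ν : Measure (Fin d → ℝ)) : ℝ :=
  sInf { r : ℝ | ∃ π : Measure ((Fin d → ℝ) × (Fin d → ℝ)),
      IsProbabilityMeasure π ∧ π.map Prod.fst = μ ∧ π.map Prod.snd = ν ∧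
      r = ∫ z, lpDist p z.1 z.2 ^ v ∂π } ^ (1 / v)

/-- The cube [0,1)^d. -/
def cube (d : ℕ) : Set (Fin d → ℝ) := {x | ∀ l, 0 ≤ x l ∧ x l < 1}

/-- The bin A_{i,b} (0-indexed): ∏_l [i_l/b, (i_l+1)/b). -/
def binSet (d b : ℕ) (i : Fin d → Fin b) : Set (Fin d → ℝ) :=
  {x | ∀ l, (i l : ℝ) / b ≤ x l ∧ x l < ((i l : ℝ) + 1) / b}

/-- Histogram probability measure with weights `w`: density Σ_i b^d w_i 1_{A_{i,b}}. -/
def histMeasure (d b : ℕ) (w : (Fin d → Fin b) → ℝ) : Measure (Fin d → ℝ) :=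
  volume.withDensity fun x =>
    ENNReal.ofReal (∑ i, (b : ℝ) ^ d * w i * Set.indicator (binSet d b i) 1 x)

/-- k_n = n^{1/(2v)} if d ≤ 2v, else n^{1/d}. -/
def kSeq (d : ℕ) (v : ℝ) (n : ℕ) : ℝ :=
  if (d : ℝ) ≤ 2 * v then (n : ℝ) ^ ((1 : ℝ) / (2 * v)) else (n : ℝ) ^ ((1 : ℝ) / d)

/-- K_n = ⌈log₂ k_n⌉. -/
def KSeq (d : ℕ) (v : ℝ) (n : ℕ) : ℕ := ⌈Real.logb 2 (kSeq d v n)⌉₊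

/-- b_n = 2^{K_n}. -/
def bSeq (d : ℕ) (v : ℝ) (n : ℕ) : ℕ := 2 ^ KSeq d v n

/-- Bin count N_j. -/
def binCount (d b : ℕ) {n : ℕ} (Y : Fin n → Fin d → ℝ) (j : Fin d → Fin b) : ℕ :=
  (Finset.univ.filter fun t => Y t ∈ binSet d b j).card

/-- Posterior mean weights π̂_j = (α_j + N_j)/(n + Σ_i α_i). -/
def postWeight (d b : ℕ) {n : ℕ} (α : (Fin d → Fin b) → ℝ) (Y : Fin n → Fin d → ℝ)
    (j : Fin d → Fin b) : ℝ :=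
  (α j + binCount d b Y j) / (n + ∑ i, α i)

/-- The posterior mean histogram P̄_n. -/
def postMeanHist (d : ℕ) (v : ℝ) {n : ℕ} (α : (Fin d → Fin (bSeq d v n)) → ℝ)
    (Y : Fin n → Fin d → ℝ) : Measure (Fin d → ℝ) :=
  histMeasure d (bSeq d v n) (postWeight d (bSeq d v n) α Y)

/-- Dirichlet(β) as the law of normalized independent Gammas. -/
def dirichlet {ι : Type*} [Fintype ι] (β : ι → ℝ) : Measure (ι → ℝ) :=
  (Measure.pi fun i => ProbabilityTheory.gammaMeasure (β i) 1).map
    fun g i => g i / ∑ j, g j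


/-- Greedy matching of two weight functions inside the fibres of `q`; the unmatched mass is
the total positive part of the fibrewise discrepancies. -/
lemma exists_fiberwise_matching {ι κ : Type*} [Fintype ι] [DecidableEq κ] (q : ι → κ) (a b : ι → ℝ)
    (ha : ∀ i, 0 ≤ a i) (hb : ∀ i, 0 ≤ b i) :
    ∃ w : ι → ι → ℝ, (∀ i j, 0 ≤ w i j) ∧ (∀ i j, q i ≠ q j → w i j = 0) ∧
      (∀ i, ∑ j, w i j ≤ a i) ∧ (∀ j, ∑ i, w i j ≤ b j) ∧
      ∑ i, (a i - ∑ j, w i j) ≤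
        ∑ c ∈ Finset.univ.image q, max 0 (∑ i with q i = c, (a i - b i)) := by
  set A : κ → ℝ := fun c => ∑ i with q i = c, a i with hA
  set B : κ → ℝ := fun c => ∑ i with q i = c, b i with hB
  have hA0 : ∀ c, 0 ≤ A c := fun c => Finset.sum_nonneg fun i _ => ha i
  have hB0 : ∀ c, 0 ≤ B c := fun c => Finset.sum_nonneg fun i _ => hb i
  have hM0 : ∀ c, 0 ≤ max (A c) (B c) := fun c => le_max_of_le_left (hA0 c)
  have hrow : ∀ i, ∑ j, (if q i = q j then a i * b j / max (A (q i)) (B (q i)) else 0)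
      = a i * (B (q i) / max (A (q i)) (B (q i))) := by
    intro i
    rw [← Finset.sum_filter, ← mul_div_assoc, hB]
    simp only
    rw [Finset.mul_sum, Finset.sum_div]
    simp only [eq_comm]
  have hcol : ∀ j, ∑ i, (if q i = q j then a i * b j / max (A (q i)) (B (q i)) else 0)
      = b j * (A (q j) / max (A (q j)) (B (q j))) := by
    intro j
    rw [← Finset.sum_filter, ← mul_div_assoc, hA]
    simp only
    rw [Finset.mul_sum, Finset.sum_div]
    refine Finset.sum_congr rfl fun i hi => ?_
    rw [(Finset.mem_filter.mp hi).2, mul_comm]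
  refine ⟨fun i j => if q i = q j then a i * b j / max (A (q i)) (B (q i)) else 0,
    ?_, ?_, ?_, ?_, ?_⟩
  · intro i j
    dsimp only
    split_ifs
    · exact div_nonneg (mul_nonneg (ha i) (hb j)) (hM0 _)
    · exact le_rfl
  · intro i j h
    simp [h]
  · intro i
    rw [hrow]
    exact mul_le_of_le_one_right (ha i) (div_le_one_of_le₀ (le_max_right _ _) (hM0 _))
  · intro j
    rw [hcol]
    exact mul_le_of_le_one_right (hb j) (div_le_one_of_le₀ (le_max_left _ _) (hM0 _))
  · rw [← Finset.sum_fiberwise_of_maps_to (t := Finset.univ.image q) (g := q)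
      (fun i _ => Finset.mem_image_of_mem q (Finset.mem_univ i))]
    refine Finset.sum_le_sum fun c _ => ?_
    have h1 : ∑ i with q i = c, (a i - ∑ j,
        (if q i = q j then a i * b j / max (A (q i)) (B (q i)) else 0))
        = A c - A c * (B c / max (A c) (B c)) := by
      rw [hA]
      simp only
      rw [Finset.sum_mul, ← Finset.sum_sub_distrib]
      refine Finset.sum_congr rfl fun i hi => ?_
      rw [hrow, (Finset.mem_filter.mp hi).2]
    have h2 : ∑ i with q i = c, (a i - b i) = A c - B c := by
      rw [Finset.sum_sub_distrib]
    rw [h1, h2]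
    rcases le_total (A c) (B c) with h | h
    · rw [max_eq_right h]
      rcases (hB0 c).eq_or_lt with h0 | h0
      · have : A c = 0 := le_antisymm (h.trans h0.symm.le) (hA0 c)
        simp [this]
      · rw [div_self h0.ne']
        simp
    · rw [max_eq_left h]
      rcases (hA0 c).eq_or_lt with h0 | h0
      · simp [← h0]
      · rw [mul_div_cancel₀ _ h0.ne']
        exact le_max_right _ _

/-- Multiscale transport plan between two weight functions of equal mass along a refining
sequence of partitions, with its cost bounded by the discrepancies at each scale. -/
lemma exists_multiscale_plan {ι κ : Type*} [Fintype ι] [DecidableEq κ] (q : ℕ → ι → κ)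
    (hq : ∀ k i j, q (k + 1) i = q (k + 1) j → q k i = q k j)
    (h0 : ∀ i j, q 0 i = q 0 j) (D : ι → ι → ℝ) (r : ℕ → ℝ) (hr : ∀ k, 0 ≤ r k) (K : ℕ)
    (hD : ∀ k ≤ K, ∀ i j, q k i = q k j → D i j ≤ r k)
    (a b : ι → ℝ) (ha : ∀ i, 0 ≤ a i) (hb : ∀ i, 0 ≤ b i) (hab : ∑ i, a i = ∑ i, b i) :
    ∃ w : ι → ι → ℝ, (∀ i j, 0 ≤ w i j) ∧ (∀ i, ∑ j, w i j = a i) ∧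
      (∀ j, ∑ i, w i j = b j) ∧
      ∑ i, ∑ j, w i j * D i j ≤ r K * ∑ i, a i + ∑ k ∈ Finset.range K, r k *
        ∑ c ∈ Finset.univ.image (q (k + 1)), max 0 (∑ i with q (k + 1) i = c, (a i - b i)) := by
  induction K generalizing a b with
  | zero =>
    have hS0 : 0 ≤ ∑ i, a i := Finset.sum_nonneg fun i _ => ha i
    refine ⟨fun i j => a i * b j / ∑ i, a i, fun i j =>
      div_nonneg (mul_nonneg (ha i) (hb j)) hS0, ?_, ?_, ?_⟩
    · intro i
      rw [← Finset.sum_div, ← Finset.mul_sum, ← hab]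
      rcases hS0.eq_or_lt with h | h
      · have := (Finset.sum_eq_zero_iff_of_nonneg fun i _ => ha i).mp h.symm i (Finset.mem_univ i)
        simp [this]
      · exact mul_div_cancel_right₀ _ h.ne'
    · intro j
      rw [← Finset.sum_div, ← Finset.sum_mul]
      rcases hS0.eq_or_lt with h | h
      · have := (Finset.sum_eq_zero_iff_of_nonneg fun i _ => hb i).mp (hab ▸ h.symm) j
          (Finset.mem_univ j)
        simp [this]
      · exact mul_div_cancel_left₀ _ h.ne'
    · have hle : ∑ i, ∑ j, a i * b j / (∑ i, a i) * D i j
          ≤ ∑ i, ∑ j, a i * b j / (∑ i, a i) * r 0 :=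
        Finset.sum_le_sum fun i _ => Finset.sum_le_sum fun j _ =>
          mul_le_mul_of_nonneg_left (hD 0 le_rfl i j (h0 i j))
            (div_nonneg (mul_nonneg (ha i) (hb j)) hS0)
      refine hle.trans (le_of_eq ?_)
      simp only [← Finset.sum_mul, ← Finset.sum_div, ← Finset.mul_sum, ← hab,
        Finset.range_zero, Finset.sum_empty, add_zero]
      rcases hS0.eq_or_lt with h | h
      · simp [← h]
      · field_simp
  | succ K ih =>
    obtain ⟨w, hw0, hwq, hwa, hwb, hwl⟩ := exists_fiberwise_matching (q (K + 1)) a b ha hb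
    have hcomm : ∑ i, ∑ j, w i j = ∑ j, ∑ i, w i j := Finset.sum_comm
    obtain ⟨u, hu0, hua, hub, hul⟩ := ih (fun k hk => hD k (hk.trans K.le_succ))
      (fun i => a i - ∑ j, w i j) (fun j => b j - ∑ i, w i j)
      (fun i => sub_nonneg.mpr (hwa i)) (fun j => sub_nonneg.mpr (hwb j))
      (by rw [Finset.sum_sub_distrib, Finset.sum_sub_distrib, hab, hcomm])
    have hanti : ∀ k ≤ K + 1, ∀ i j, q (K + 1) i = q (K + 1) j → q k i = q k j := by
      intro k hk i j h
      induction hk using Nat.decreasingInduction with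
      | self => exact h
      | of_succ k _ ih => exact hq k i j ih
    have hdiff : ∀ k ≤ K + 1, ∀ c, ∑ i with q k i = c,
        ((a i - ∑ j, w i j) - (b i - ∑ j, w j i)) = ∑ i with q k i = c, (a i - b i) := by
      intro k hk c
      have h1 : ∑ i with q k i = c, ∑ j, w i j = ∑ i with q k i = c, ∑ j, w j i := by
        simp only [Finset.sum_filter]
        have e1 : ∀ i, (if q k i = c then ∑ j, w i j else 0)
            = ∑ j, if q k i = c then w i j else 0 := by
          intro i; split_ifs <;> simp
        have e2 : ∀ i, (if q k i = c then ∑ j, w j i else 0)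
            = ∑ j, if q k j = c then w j i else 0 := by
          intro i
          rw [← Finset.sum_filter, Finset.sum_filter]
          split_ifs with h
          · refine Finset.sum_congr rfl fun j _ => ?_
            split_ifs with h'
            · rfl
            · exact hwq _ _ fun e => h' ((hanti k hk _ _ e).trans h)
          · refine (Finset.sum_eq_zero fun j _ => ?_).symm
            split_ifs with h'
            · exact hwq _ _ fun e => h ((hanti k hk _ _ e).symm.trans h')
            · rfl
        simp only [e1, e2]
        exact Finset.sum_comm
      simp only [Finset.sum_sub_distrib]
      rw [h1]
      ring
    refine ⟨fun i j => w i j + u i j, fun i j => add_nonneg (hw0 i j) (hu0 i j), ?_, ?_, ?_⟩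
    · intro i
      rw [Finset.sum_add_distrib, hua]
      ring
    · intro j
      rw [Finset.sum_add_distrib, hub]
      ring
    · have hwD : ∑ i, ∑ j, w i j * D i j ≤ r (K + 1) * ∑ i, a i := by
        rw [Finset.mul_sum]
        refine Finset.sum_le_sum fun i _ => ?_
        calc ∑ j, w i j * D i j ≤ ∑ j, r (K + 1) * w i j := by
              refine Finset.sum_le_sum fun j _ => ?_
              by_cases h : q (K + 1) i = q (K + 1) j
              · rw [mul_comm]
                exact mul_le_mul_of_nonneg_right (hD _ le_rfl i j h) (hw0 i j)
              · simp [hwq i j h]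
          _ ≤ r (K + 1) * a i := by
              rw [← Finset.mul_sum]
              exact mul_le_mul_of_nonneg_left (hwa i) (hr _)
      have hrest : ∑ k ∈ Finset.range K, r k * ∑ c ∈ Finset.univ.image (q (k + 1)),
          max 0 (∑ i with q (k + 1) i = c, ((a i - ∑ j, w i j) - (b i - ∑ j, w j i)))
          = ∑ k ∈ Finset.range K, r k * ∑ c ∈ Finset.univ.image (q (k + 1)),
          max 0 (∑ i with q (k + 1) i = c, (a i - b i)) := by
        refine Finset.sum_congr rfl fun k hk => ?_
        have hk' : k + 1 ≤ K + 1 := by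
          have := Finset.mem_range.mp hk
          omega
        simp only [hdiff (k + 1) hk']
      rw [hrest] at hul
      have hK := mul_le_mul_of_nonneg_left hwl (hr K)
      simp only [add_mul, Finset.sum_add_distrib]
      rw [Finset.sum_range_succ]
      linarith

lemma lpDist_nonneg (p : ℝ) {d : ℕ} (x y : Fin d → ℝ) : 0 ≤ lpDist p x y :=
  Real.rpow_nonneg (Finset.sum_nonneg fun _ _ => Real.rpow_nonneg (abs_nonneg _) _) _

lemma measurable_lpDist (p : ℝ) {d : ℕ} :
    Measurable fun z : (Fin d → ℝ) × (Fin d → ℝ) => lpDist p z.1 z.2 := by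
  unfold lpDist
  refine Measurable.pow_const (Finset.measurable_sum _ fun l _ => Measurable.pow_const ?_ _) _
  have h : Measurable fun z : (Fin d → ℝ) × (Fin d → ℝ) => z.1 l - z.2 l :=
    ((measurable_pi_apply l).comp measurable_fst).sub
      ((measurable_pi_apply l).comp measurable_snd)
  exact h.abs

lemma wassersteinLp_le_of_coupling (p v : ℝ) (hv : 0 < v) {d : ℕ}
    {μ ν : Measure (Fin d → ℝ)} (π : Measure ((Fin d → ℝ) × (Fin d → ℝ)))
    [IsProbabilityMeasure π] (h₁ : π.map Prod.fst = μ) (h₂ : π.map Prod.snd = ν) {t : ℝ}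
    (ht : ∫ z, lpDist p z.1 z.2 ^ v ∂π ≤ t) : wassersteinLp p v μ ν ≤ t ^ (1 / v) := by
  have hnn : ∀ r ∈ { r : ℝ | ∃ π : Measure ((Fin d → ℝ) × (Fin d → ℝ)),
      IsProbabilityMeasure π ∧ π.map Prod.fst = μ ∧ π.map Prod.snd = ν ∧
      r = ∫ z, lpDist p z.1 z.2 ^ v ∂π }, 0 ≤ r := by
    rintro r ⟨π, _, _, _, rfl⟩
    exact integral_nonneg fun z => Real.rpow_nonneg (lpDist_nonneg p _ _) _
  refine Real.rpow_le_rpow (Real.sInf_nonneg hnn) ?_ (by positivity)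
  exact (csInf_le ⟨0, hnn⟩ ⟨π, inferInstance, h₁, h₂, rfl⟩).trans ht

lemma wassersteinLp_nonneg (p v : ℝ) {d : ℕ} (μ ν : Measure (Fin d → ℝ)) :
    0 ≤ wassersteinLp p v μ ν := by
  refine Real.rpow_nonneg (Real.sInf_nonneg ?_) _
  rintro r ⟨π, _, _, _, rfl⟩
  exact integral_nonneg fun z => Real.rpow_nonneg (lpDist_nonneg p _ _) _

/-- A transport plan between the masses of the cells of a partition lifts to a coupling. -/
lemma wassersteinLp_le_of_plan (p v : ℝ) (hv : 0 < v) {d : ℕ} {ι : Type*} [Fintype ι]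
    (μ ν : Measure (Fin d → ℝ)) [IsProbabilityMeasure μ] [IsProbabilityMeasure ν]
    (A : ι → Set (Fin d → ℝ)) (hA : ∀ i, MeasurableSet (A i))
    (hdisj : Pairwise (Function.onFun Disjoint A))
    (hμ : ∀ᵐ x ∂μ, x ∈ ⋃ i, A i) (hν : ∀ᵐ x ∂ν, x ∈ ⋃ i, A i)
    (D : ι → ι → ℝ) (hD0 : ∀ i j, 0 ≤ D i j)
    (hD : ∀ i j, ∀ x ∈ A i, ∀ y ∈ A j, lpDist p x y ^ v ≤ D i j)
    (w : ι → ι → ℝ) (hw0 : ∀ i j, 0 ≤ w i j) (hwa : ∀ i, ∑ j, w i j = μ.real (A i))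
    (hwb : ∀ j, ∑ i, w i j = ν.real (A j)) :
    wassersteinLp p v μ ν ≤ (∑ i, ∑ j, w i j * D i j) ^ (1 / v) := by
  have hwa' : ∀ i j, μ.real (A i) = 0 → w i j = 0 := fun i j h =>
    (Finset.sum_eq_zero_iff_of_nonneg fun j _ => hw0 i j).mp ((hwa i).trans h) j
      (Finset.mem_univ j)
  have hwb' : ∀ i j, ν.real (A j) = 0 → w i j = 0 := fun i j h =>
    (Finset.sum_eq_zero_iff_of_nonneg fun i _ => hw0 i j).mp ((hwb j).trans h) i
      (Finset.mem_univ i)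
  have hdiv : ∀ i j, 0 ≤ w i j / (μ.real (A i) * ν.real (A j)) := fun i j =>
    div_nonneg (hw0 i j) (mul_nonneg measureReal_nonneg measureReal_nonneg)
  have hsum : ∀ (ρ : Measure (Fin d → ℝ)), (∀ᵐ x ∂ρ, x ∈ ⋃ i, A i) →
      ∑ i, ρ.restrict (A i) = ρ := by
    intro ρ hρ
    rw [← Measure.sum_fintype, ← Measure.restrict_iUnion hdisj hA]
    exact Measure.restrict_eq_self_of_ae_mem hρ
  set π : Measure ((Fin d → ℝ) × (Fin d → ℝ)) := ∑ i, ∑ j,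
    ENNReal.ofReal (w i j / (μ.real (A i) * ν.real (A j))) •
      (μ.restrict (A i)).prod (ν.restrict (A j)) with hπ
  have hfst : π.map Prod.fst = μ := by
    rw [hπ, Measure.map_finset_sum' measurable_fst.aemeasurable]
    refine Eq.trans (Finset.sum_congr rfl fun i _ => ?_) (hsum μ hμ)
    rw [Measure.map_finset_sum' measurable_fst.aemeasurable]
    simp only [Measure.map_smul, Measure.map_fst_prod, Measure.restrict_apply_univ, smul_smul]
    rw [← Finset.sum_smul]
    by_cases h : μ.real (A i) = 0
    · have : μ (A i) = 0 := (measureReal_eq_zero_iff).mp h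
      rw [Measure.restrict_eq_zero.mpr this, smul_zero]
    · have : ∀ j, ENNReal.ofReal (w i j / (μ.real (A i) * ν.real (A j))) * ν (A j)
          = ENNReal.ofReal (w i j / μ.real (A i)) := by
        intro j
        rw [← ofReal_measureReal (μ := ν) (s := A j), ← ENNReal.ofReal_mul (hdiv i j)]
        congr 1
        by_cases h' : ν.real (A j) = 0
        · simp [hwb' i j h']
        · field_simp
      simp only [this]
      rw [← ENNReal.ofReal_sum_of_nonneg fun j _ => div_nonneg (hw0 i j) measureReal_nonneg,
        ← Finset.sum_div, hwa, div_self h, ENNReal.ofReal_one, one_smul]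
  have hsnd : π.map Prod.snd = ν := by
    rw [hπ, Finset.sum_comm, Measure.map_finset_sum' measurable_snd.aemeasurable]
    refine Eq.trans (Finset.sum_congr rfl fun j _ => ?_) (hsum ν hν)
    rw [Measure.map_finset_sum' measurable_snd.aemeasurable]
    simp only [Measure.map_smul, Measure.map_snd_prod, Measure.restrict_apply_univ, smul_smul]
    rw [← Finset.sum_smul]
    by_cases h : ν.real (A j) = 0
    · have : ν (A j) = 0 := (measureReal_eq_zero_iff).mp h
      rw [Measure.restrict_eq_zero.mpr this, smul_zero]
    · have : ∀ i, ENNReal.ofReal (w i j / (μ.real (A i) * ν.real (A j))) * μ (A i)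
          = ENNReal.ofReal (w i j / ν.real (A j)) := by
        intro i
        rw [← ofReal_measureReal (μ := μ) (s := A i), ← ENNReal.ofReal_mul (hdiv i j)]
        congr 1
        by_cases h' : μ.real (A i) = 0
        · simp [hwa' i j h']
        · field_simp
      simp only [this]
      rw [← ENNReal.ofReal_sum_of_nonneg fun i _ => div_nonneg (hw0 i j) measureReal_nonneg,
        ← Finset.sum_div, hwb, div_self h, ENNReal.ofReal_one, one_smul]
  have hprob : IsProbabilityMeasure π := by
    constructor
    have h1 : π.map Prod.fst Set.univ = 1 := by rw [hfst]; exact measure_univ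
    rwa [Measure.map_apply measurable_fst MeasurableSet.univ, Set.preimage_univ] at h1
  refine wassersteinLp_le_of_coupling p v hv π hfst hsnd ?_
  have hmeas := (measurable_lpDist p (d := d)).pow_const v
  have hcost0 : 0 ≤ ∑ i, ∑ j, w i j * D i j :=
    Finset.sum_nonneg fun i _ => Finset.sum_nonneg fun j _ => mul_nonneg (hw0 i j) (hD0 i j)
  rw [integral_eq_lintegral_of_nonneg_ae
    (Eventually.of_forall fun z => Real.rpow_nonneg (lpDist_nonneg p _ _) _)
    hmeas.aestronglyMeasurable]
  refine ENNReal.toReal_le_of_le_ofReal hcost0 ?_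
  rw [ENNReal.ofReal_sum_of_nonneg fun i _ => Finset.sum_nonneg fun j _ =>
    mul_nonneg (hw0 i j) (hD0 i j), hπ, lintegral_finsetSum_measure]
  refine Finset.sum_le_sum fun i _ => ?_
  rw [ENNReal.ofReal_sum_of_nonneg fun j _ => mul_nonneg (hw0 i j) (hD0 i j),
    lintegral_finsetSum_measure]
  refine Finset.sum_le_sum fun j _ => ?_
  rw [lintegral_smul_measure, Measure.prod_restrict]
  have hle : ∫⁻ z in A i ×ˢ A j, ENNReal.ofReal (lpDist p z.1 z.2 ^ v) ∂(μ.prod ν)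
      ≤ ENNReal.ofReal (D i j) * (ENNReal.ofReal (μ.real (A i)) *
        ENNReal.ofReal (ν.real (A j))) := by
    rw [ofReal_measureReal, ofReal_measureReal, ← Measure.prod_prod, ← setLIntegral_const]
    refine setLIntegral_mono measurable_const fun z hz => ?_
    exact ENNReal.ofReal_le_ofReal (hD i j _ hz.1 _ hz.2)
  rw [smul_eq_mul]
  refine (mul_le_mul_right hle _).trans (le_of_eq ?_)
  rw [← ENNReal.ofReal_mul measureReal_nonneg, ← ENNReal.ofReal_mul (hD0 i j),
    ← ENNReal.ofReal_mul (hdiv i j)]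
  congr 1
  by_cases h : μ.real (A i) = 0
  · simp [hwa' i j h]
  by_cases h' : ν.real (A j) = 0
  · simp [hwb' i j h']
  field_simp

lemma measurableSet_binSet (d b : ℕ) (i : Fin d → Fin b) : MeasurableSet (binSet d b i) := by
  have : binSet d b i = Set.pi Set.univ
      fun l => Set.Ico ((i l : ℝ) / b) (((i l : ℝ) + 1) / b) := by
    ext x; simp [binSet]
  rw [this]
  exact MeasurableSet.univ_pi fun l => measurableSet_Ico

lemma measurableSet_cube (d : ℕ) : MeasurableSet (cube d) := by
  have : cube d = Set.pi Set.univ fun _ => Set.Ico (0 : ℝ) 1 := by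
    ext x; simp [cube]
  rw [this]
  exact MeasurableSet.univ_pi fun l => measurableSet_Ico

lemma floor_eq_of_mem_binSet {d b : ℕ} {i : Fin d → Fin b} {x : Fin d → ℝ}
    (hx : x ∈ binSet d b i) (l : Fin d) : ⌊x l * b⌋₊ = i l := by
  have hb : (0 : ℝ) < b := by exact_mod_cast (i l).pos
  obtain ⟨h1, h2⟩ := hx l
  rw [div_le_iff₀ hb] at h1
  rw [lt_div_iff₀ hb] at h2
  exact (Nat.floor_eq_iff (le_trans (Nat.cast_nonneg _) h1)).mpr ⟨h1, h2⟩

lemma eq_of_mem_binSet {d b : ℕ} {i j : Fin d → Fin b} {x : Fin d → ℝ}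
    (hi : x ∈ binSet d b i) (hj : x ∈ binSet d b j) : i = j := by
  funext l
  exact Fin.ext ((floor_eq_of_mem_binSet hi l).symm.trans (floor_eq_of_mem_binSet hj l))

lemma pairwise_disjoint_binSet (d b : ℕ) : Pairwise (Function.onFun Disjoint (binSet d b)) :=
  fun _ _ hij => Set.disjoint_left.mpr fun _ hi hj => hij (eq_of_mem_binSet hi hj)

lemma exists_mem_binSet {d b : ℕ} (hb : 0 < b) {x : Fin d → ℝ} (hx : x ∈ cube d) :
    ∃ i, x ∈ binSet d b i := by
  have hb' : (0 : ℝ) < b := by exact_mod_cast hb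
  have h0 : ∀ l, 0 ≤ x l * b := fun l => mul_nonneg (hx l).1 hb'.le
  refine ⟨fun l => ⟨⌊x l * b⌋₊, (Nat.floor_lt (h0 l)).mpr ?_⟩, fun l => ⟨?_, ?_⟩⟩
  · nlinarith [(hx l).2]
  · rw [div_le_iff₀ hb']
    exact Nat.floor_le (h0 l)
  · rw [lt_div_iff₀ hb']
    exact Nat.lt_floor_add_one _

lemma sum_indicator_binSet {d b : ℕ} (g : (Fin d → Fin b) → ℝ) {j : Fin d → Fin b}
    {x : Fin d → ℝ} (hx : x ∈ binSet d b j) :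
    ∑ i, g i * Set.indicator (binSet d b i) 1 x = g j := by
  rw [Finset.sum_eq_single j]
  · simp [hx]
  · intro i _ hij
    rw [Set.indicator_of_notMem fun h => hij (eq_of_mem_binSet h hx), mul_zero]
  · simp

lemma volume_binSet {d b : ℕ} (hb : 0 < b) (i : Fin d → Fin b) :
    volume (binSet d b i) = ENNReal.ofReal ((b : ℝ) ^ d)⁻¹ := by
  have : binSet d b i = Set.pi Set.univ
      fun l => Set.Ico ((i l : ℝ) / b) (((i l : ℝ) + 1) / b) := by
    ext x; simp [binSet]
  rw [this, Real.volume_pi_Ico]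
  have h : ∀ l, ((i l : ℝ) + 1) / b - (i l : ℝ) / b = (b : ℝ)⁻¹ := fun l => by ring
  simp only [h, Finset.prod_const, Finset.card_univ, Fintype.card_fin]
  rw [← ENNReal.ofReal_pow (by positivity), inv_pow]

lemma histMeasure_binSet {d b : ℕ} (hb : 0 < b) (w : (Fin d → Fin b) → ℝ)
    (j : Fin d → Fin b) : histMeasure d b w (binSet d b j) = ENNReal.ofReal (w j) := by
  have hb' : (0 : ℝ) < (b : ℝ) ^ d := by positivity
  rw [histMeasure, withDensity_apply _ (measurableSet_binSet d b j),
    setLIntegral_congr_fun (g := fun _ => ENNReal.ofReal ((b : ℝ) ^ d * w j))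
      (measurableSet_binSet d b j)
      fun x hx => by rw [sum_indicator_binSet (fun i => (b : ℝ) ^ d * w i) hx],
    setLIntegral_const, volume_binSet hb, ← ENNReal.ofReal_mul' (by positivity)]
  congr 1
  field_simp

lemma ae_mem_binSet_histMeasure {d b : ℕ} (w : (Fin d → Fin b) → ℝ) :
    ∀ᵐ x ∂histMeasure d b w, x ∈ ⋃ i, binSet d b i := by
  have hm : MeasurableSet (⋃ i, binSet d b i) :=
    MeasurableSet.iUnion fun i => measurableSet_binSet d b i
  change histMeasure d b w (⋃ i, binSet d b i)ᶜ = 0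
  rw [histMeasure, withDensity_apply _ hm.compl,
    setLIntegral_congr_fun (g := fun _ => 0) hm.compl, lintegral_zero]
  intro x hx
  have : ∀ i, x ∉ binSet d b i := fun i hi => hx (Set.mem_iUnion.mpr ⟨i, hi⟩)
  simp [this]

lemma isProbabilityMeasure_histMeasure {d b : ℕ} (hb : 0 < b) (w : (Fin d → Fin b) → ℝ)
    (hw : ∀ i, 0 ≤ w i) (hw1 : ∑ i, w i = 1) : IsProbabilityMeasure (histMeasure d b w) := by
  constructor
  rw [← (measure_eq_measure_of_null_sdiff (Set.subset_univ (⋃ i, binSet d b i)) (by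
    rw [← Set.compl_eq_univ_sdiff]; exact ae_mem_binSet_histMeasure w)),
    measure_iUnion (pairwise_disjoint_binSet d b) (measurableSet_binSet d b), tsum_fintype]
  simp only [histMeasure_binSet hb]
  rw [← ENNReal.ofReal_sum_of_nonneg fun i _ => hw i, hw1, ENNReal.ofReal_one]

/-- Index of the dyadic cell of side `2 ^ (-k)` containing the bin `i` of side `2 ^ (-K)`. -/
def dyadicCell (d K k : ℕ) (i : Fin d → Fin (2 ^ K)) : Fin d → ℕ :=
  fun l => (i l : ℕ) / 2 ^ (K - k)

lemma dyadicCell_refines {d K : ℕ} (k : ℕ) (i j : Fin d → Fin (2 ^ K))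
    (h : dyadicCell d K (k + 1) i = dyadicCell d K (k + 1) j) :
    dyadicCell d K k i = dyadicCell d K k j := by
  rcases le_or_gt K k with hk | hk
  · have h1 : K - (k + 1) = K - k := by omega
    funext l
    have := congrFun h l
    simp only [dyadicCell, h1] at this ⊢
    exact this
  · have h1 : K - k = (K - (k + 1)) + 1 := by omega
    funext l
    have := congrFun h l
    simp only [dyadicCell] at this ⊢
    rw [h1, pow_succ, ← Nat.div_div_eq_div_mul, ← Nat.div_div_eq_div_mul, this]

lemma dyadicCell_zero {d K : ℕ} (i j : Fin d → Fin (2 ^ K)) :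
    dyadicCell d K 0 i = dyadicCell d K 0 j := by
  funext l
  simp only [dyadicCell, Nat.sub_zero]
  rw [Nat.div_eq_of_lt (i l).isLt, Nat.div_eq_of_lt (j l).isLt]

lemma card_image_dyadicCell {d K k : ℕ} (hk : k ≤ K) :
    (Finset.univ.image (dyadicCell d K k)).card ≤ (2 ^ k) ^ d := by
  have : Finset.univ.image (dyadicCell d K k)
      ⊆ Fintype.piFinset fun _ : Fin d => Finset.range (2 ^ k) := by
    intro c hc
    obtain ⟨i, -, rfl⟩ := Finset.mem_image.mp hc
    rw [Fintype.mem_piFinset]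
    intro l
    rw [Finset.mem_range, dyadicCell, Nat.div_lt_iff_lt_mul (by positivity), ← pow_add,
      Nat.add_sub_cancel' hk]
    exact (i l).isLt
  refine (Finset.card_le_card this).trans ?_
  simp

lemma abs_sub_le_of_dyadicCell_eq {d K k : ℕ} (hk : k ≤ K) {i j : Fin d → Fin (2 ^ K)}
    (h : dyadicCell d K k i = dyadicCell d K k j) {x y : Fin d → ℝ}
    (hx : x ∈ binSet d (2 ^ K) i) (hy : y ∈ binSet d (2 ^ K) j) (l : Fin d) :
    |x l - y l| ≤ ((2 : ℝ) ^ k)⁻¹ := by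
  have key : ∀ {i : Fin d → Fin (2 ^ K)} {x : Fin d → ℝ}, x ∈ binSet d (2 ^ K) i →
      (dyadicCell d K k i l : ℝ) ≤ x l * 2 ^ k ∧
        x l * 2 ^ k < (dyadicCell d K k i l : ℝ) + 1 := by
    intro i x hx
    have hpow : (2 : ℝ) ^ K = 2 ^ k * 2 ^ (K - k) := by
      rw [← pow_add, Nat.add_sub_cancel' hk]
    have hp : (0 : ℝ) < 2 ^ (K - k) := by positivity
    obtain ⟨h1, h2⟩ := hx l
    push_cast at h1 h2
    rw [div_le_iff₀ (by positivity), hpow] at h1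
    rw [lt_div_iff₀ (by positivity), hpow] at h2
    have h3 : ((i l : ℕ) / 2 ^ (K - k) : ℕ) * 2 ^ (K - k) ≤ (i l : ℕ) := Nat.div_mul_le_self _ _
    have h4 : (i l : ℕ) + 1 ≤ ((i l : ℕ) / 2 ^ (K - k) + 1) * 2 ^ (K - k) :=
      Nat.lt_mul_of_div_lt (Nat.lt_succ_self _) (by positivity)
    have h3' : (((i l : ℕ) / 2 ^ (K - k) : ℕ) : ℝ) * 2 ^ (K - k) ≤ (i l : ℕ) := by
      exact_mod_cast h3
    have h4' : ((i l : ℕ) : ℝ) + 1 ≤ ((((i l : ℕ) / 2 ^ (K - k) : ℕ) : ℝ) + 1) * 2 ^ (K - k) := by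
      exact_mod_cast h4
    simp only [dyadicCell]
    constructor
    · refine le_of_mul_le_mul_right ?_ hp
      linarith
    · refine lt_of_mul_lt_mul_right ?_ hp.le
      linarith
  obtain ⟨h1, h2⟩ := key hx
  obtain ⟨h3, h4⟩ := key hy
  rw [h] at h1 h2
  rw [← one_div, le_div_iff₀ (by positivity), ← abs_of_pos (show (0 : ℝ) < 2 ^ k by positivity),
    ← abs_mul, abs_le]
  constructor <;> linarith

lemma lpDist_le_of_abs_sub_le {p : ℝ} (hp : 1 ≤ p) {d : ℕ} (hd : 1 ≤ d) {x y : Fin d → ℝ}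
    {t : ℝ} (ht : 0 ≤ t) (h : ∀ l, |x l - y l| ≤ t) : lpDist p x y ≤ d * t := by
  have hp0 : 0 < p := by linarith
  have hd1 : (1 : ℝ) ≤ d := by exact_mod_cast hd
  have h1 : ∑ l, |x l - y l| ^ p ≤ d * t ^ p := by
    calc ∑ l, |x l - y l| ^ p ≤ ∑ _l : Fin d, t ^ p :=
          Finset.sum_le_sum fun l _ => Real.rpow_le_rpow (abs_nonneg _) (h l) hp0.le
      _ = d * t ^ p := by simp
  have h2 : (d : ℝ) * t ^ p ≤ (d * t) ^ p := by
    rw [Real.mul_rpow (by positivity) ht]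
    exact mul_le_mul_of_nonneg_right (Real.self_le_rpow_of_one_le hd1 hp) (by positivity)
  calc lpDist p x y ≤ ((d * t) ^ p) ^ (1 / p) :=
        Real.rpow_le_rpow (Finset.sum_nonneg fun _ _ => Real.rpow_nonneg (abs_nonneg _) _)
          (h1.trans h2) (by positivity)
    _ = d * t := by
        rw [one_div, Real.rpow_rpow_inv (by positivity) hp0.ne']

/-- The empirical frequency of a set has mean squared error at most `P U / n`. -/
lemma integral_sq_sub_frequency_le {X : Type*} [MeasurableSpace X] (P : Measure X)
    [IsProbabilityMeasure P] {n : ℕ} (hn : 0 < n) {U : Set X} (hU : MeasurableSet U) :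
    Integrable (fun Y : Fin n → X => (P.real U - (∑ t, U.indicator (1 : X → ℝ) (Y t)) / n) ^ 2)
        (Measure.pi fun _ => P) ∧
      ∫ Y : Fin n → X, (P.real U - (∑ t, U.indicator (1 : X → ℝ) (Y t)) / n) ^ 2
        ∂(Measure.pi fun _ => P) ≤ P.real U / n := by
  have hn' : (0 : ℝ) < n := by exact_mod_cast hn
  have hL : MemLp (U.indicator (1 : X → ℝ)) 2 P :=
    (memLp_const (1 : ℝ)).indicator hU
  have hLt : ∀ t : Fin n, MemLp (fun Y : Fin n → X => U.indicator (1 : X → ℝ) (Y t)) 2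
      (Measure.pi fun _ => P) := fun t =>
    hL.comp_measurePreserving (measurePreserving_eval (fun _ => P) t)
  have hS : MemLp (fun Y : Fin n → X => ∑ t, U.indicator (1 : X → ℝ) (Y t)) 2
      (Measure.pi fun _ => P) := memLp_finsetSum _ fun t _ => hLt t
  have hmean : ∫ Y : Fin n → X, ∑ t, U.indicator (1 : X → ℝ) (Y t) ∂(Measure.pi fun _ => P)
      = n * P.real U := by
    rw [integral_finsetSum _ fun t _ => (hLt t).integrable (by norm_num)]
    have : ∀ t : Fin n, ∫ Y : Fin n → X, U.indicator (1 : X → ℝ) (Y t)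
        ∂(Measure.pi fun _ => P) = P.real U := fun t => by
      rw [integral_comp_eval (μ := fun _ : Fin n => P) hL.aestronglyMeasurable,
        integral_indicator_one hU]
    simp [this]
  have hvar : ∫ Y : Fin n → X, (∑ t, U.indicator (1 : X → ℝ) (Y t) - n * P.real U) ^ 2
      ∂(Measure.pi fun _ => P) ≤ n * P.real U := by
    have h1 := ProbabilityTheory.variance_sum_pi (μ := fun _ : Fin n => P)
      (X := fun _ => U.indicator (1 : X → ℝ)) fun _ => hL
    have h2 : (∑ t : Fin n, fun Y : Fin n → X => U.indicator (1 : X → ℝ) (Y t))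
        = fun Y => ∑ t, U.indicator (1 : X → ℝ) (Y t) := by
      ext Y; simp
    rw [h2, ProbabilityTheory.variance_eq_integral hS.aemeasurable, hmean] at h1
    rw [h1]
    have h3 : ProbabilityTheory.variance (U.indicator (1 : X → ℝ)) P ≤ P.real U := by
      refine (ProbabilityTheory.variance_le_expectation_sq hL.aestronglyMeasurable).trans
        (le_of_eq ?_)
      rw [← integral_indicator_one hU]
      congr 1
      ext x
      by_cases hx : x ∈ U <;> simp [hx]
    calc _ ≤ ∑ _t : Fin n, P.real U := Finset.sum_le_sum fun _ _ => h3
      _ = n * P.real U := by simp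
  have hrw : (fun Y : Fin n → X => (P.real U - (∑ t, U.indicator (1 : X → ℝ) (Y t)) / n) ^ 2)
      = fun Y => ((n : ℝ) ^ 2)⁻¹ *
        (∑ t, U.indicator (1 : X → ℝ) (Y t) - n * P.real U) ^ 2 := by
    ext Y
    field_simp
    ring
  rw [hrw]
  refine ⟨((hS.sub (memLp_const _)).integrable_sq).const_mul _, ?_⟩
  rw [integral_const_mul, inv_mul_le_iff₀ (by positivity)]
  refine hvar.trans (le_of_eq ?_)
  field_simp

/-- Union of the bins of side `2 ^ (-K)` lying in the dyadic cell `c` of side `2 ^ (-k)`. -/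
def dyadicSet (d K k : ℕ) (c : Fin d → ℕ) : Set (Fin d → ℝ) :=
  ⋃ i ∈ Finset.univ.filter (fun i => dyadicCell d K k i = c), binSet d (2 ^ K) i

lemma measurableSet_dyadicSet (d K k : ℕ) (c : Fin d → ℕ) :
    MeasurableSet (dyadicSet d K k c) :=
  Finset.measurableSet_biUnion _ fun i _ => measurableSet_binSet d _ i

lemma measureReal_dyadicSet {d : ℕ} (P : Measure (Fin d → ℝ)) [IsProbabilityMeasure P] (K k : ℕ)
    (c : Fin d → ℕ) : P.real (dyadicSet d K k c)
      = ∑ i with dyadicCell d K k i = c, P.real (binSet d (2 ^ K) i) :=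
  measureReal_biUnion_finset (fun _ _ _ _ hij => pairwise_disjoint_binSet d _ hij)
    fun i _ => measurableSet_binSet d _ i

lemma sum_measureReal_binSet {d b : ℕ} (P : Measure (Fin d → ℝ))
    [IsProbabilityMeasure P] (hP : ∀ᵐ x ∂P, x ∈ ⋃ i, binSet d b i) :
    ∑ i, P.real (binSet d b i) = 1 := by
  rw [← measureReal_biUnion_finset (fun _ _ _ _ hij => pairwise_disjoint_binSet d b hij)
    fun i _ => measurableSet_binSet d b i]
  simp only [Finset.mem_univ, Set.iUnion_true]
  rw [measureReal_def, (mem_ae_iff_prob_eq_one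
    (MeasurableSet.iUnion fun i => measurableSet_binSet d b i)).mp hP, ENNReal.toReal_one]

lemma sum_measureReal_dyadicSet_le {d : ℕ} (P : Measure (Fin d → ℝ)) [IsProbabilityMeasure P]
    (K k : ℕ) : ∑ c ∈ Finset.univ.image (dyadicCell d K k), P.real (dyadicSet d K k c) ≤ 1 := by
  simp only [measureReal_dyadicSet]
  rw [Finset.sum_fiberwise_of_maps_to
      (fun i _ => Finset.mem_image_of_mem _ (Finset.mem_univ i)),
    ← measureReal_biUnion_finset (fun _ _ _ _ hij => pairwise_disjoint_binSet d _ hij)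
      fun i _ => measurableSet_binSet d _ i]
  exact measureReal_le_one

lemma sum_binCount_dyadicCell {d K : ℕ} (k : ℕ) {n : ℕ} (Y : Fin n → Fin d → ℝ)
    (c : Fin d → ℕ) : ∑ i with dyadicCell d K k i = c, (binCount d (2 ^ K) Y i : ℝ)
      = ∑ t, (dyadicSet d K k c).indicator (1 : (Fin d → ℝ) → ℝ) (Y t) := by
  have h : ∀ i, (binCount d (2 ^ K) Y i : ℝ)
      = ∑ t, (binSet d (2 ^ K) i).indicator (1 : (Fin d → ℝ) → ℝ) (Y t) := by
    intro i
    simp [binCount, Set.indicator_apply]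
  simp only [h]
  rw [Finset.sum_comm]
  refine Finset.sum_congr rfl fun t _ => ?_
  exact (Finset.indicator_biUnion_apply _ _
    (fun _ _ _ _ hij => pairwise_disjoint_binSet d _ hij) _).symm

lemma sum_binCount {d b : ℕ} (hb : 0 < b) {n : ℕ} (Y : Fin n → Fin d → ℝ)
    (hY : ∀ t, Y t ∈ cube d) : ∑ i, (binCount d b Y i : ℝ) = n := by
  have h : ∀ i, (binCount d b Y i : ℝ)
      = ∑ t, 1 * (binSet d b i).indicator (1 : (Fin d → ℝ) → ℝ) (Y t) := by
    intro i
    simp [binCount, Set.indicator_apply]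
  simp only [h]
  rw [Finset.sum_comm]
  have h1 : ∀ t, ∑ i, 1 * (binSet d b i).indicator (1 : (Fin d → ℝ) → ℝ) (Y t) = 1 := by
    intro t
    obtain ⟨j, hj⟩ := exists_mem_binSet hb (hY t)
    exact sum_indicator_binSet (fun _ => 1) hj
  simp only [h1]
  simp

/-- Multiscale bound on the Wasserstein distance between a distribution on the cube and the
posterior mean histogram on the dyadic grid of side `2 ^ (-K)`. -/
lemma wassersteinLp_postWeight_le {d : ℕ} (hd : 1 ≤ d) {p v : ℝ} (hp : 1 ≤ p) (hv : 0 < v)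
    (K : ℕ) {n : ℕ} (hn : 0 < n) (α : (Fin d → Fin (2 ^ K)) → ℝ) (hα : ∀ j, 0 ≤ α j)
    (P : Measure (Fin d → ℝ)) [IsProbabilityMeasure P] (hP : P (cube d) = 1)
    (Y : Fin n → Fin d → ℝ) (hY : ∀ t, Y t ∈ cube d) :
    wassersteinLp p v P (histMeasure d (2 ^ K) (postWeight d (2 ^ K) α Y)) ≤
      ((d * ((2 : ℝ) ^ K)⁻¹) ^ v + ∑ k ∈ Finset.range K, (d * ((2 : ℝ) ^ k)⁻¹) ^ v *
        ((∑ j, α j) / n + ∑ c ∈ Finset.univ.image (dyadicCell d K (k + 1)),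
          |P.real (dyadicSet d K (k + 1) c) -
            (∑ t, (dyadicSet d K (k + 1) c).indicator (1 : (Fin d → ℝ) → ℝ) (Y t)) / n|))
        ^ (1 / v) := by
  have hn' : (0 : ℝ) < n := by exact_mod_cast hn
  have hb : 0 < 2 ^ K := by positivity
  set s := ∑ j, α j with hs
  have hs0 : 0 ≤ s := Finset.sum_nonneg fun j _ => hα j
  have hns : 0 < n + s := by positivity
  have hw0 : ∀ j, 0 ≤ postWeight d (2 ^ K) α Y j := fun j =>
    div_nonneg (add_nonneg (hα j) (Nat.cast_nonneg _)) hns.le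
  have hw1 : ∑ j, postWeight d (2 ^ K) α Y j = 1 := by
    simp only [postWeight]
    rw [← Finset.sum_div, Finset.sum_add_distrib, sum_binCount hb Y hY, ← hs, add_comm,
      div_self hns.ne']
  have := isProbabilityMeasure_histMeasure hb _ hw0 hw1
  have hPae : ∀ᵐ x ∂P, x ∈ ⋃ i, binSet d (2 ^ K) i := by
    have hcube : ∀ᵐ x ∂P, x ∈ cube d :=
      (mem_ae_iff_prob_eq_one (measurableSet_cube d)).mpr hP
    filter_upwards [hcube] with x hx
    exact Set.mem_iUnion.mpr (exists_mem_binSet hb hx)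
  have hsumP : ∑ i, P.real (binSet d (2 ^ K) i) = 1 :=
    sum_measureReal_binSet P hPae
  set r : ℕ → ℝ := fun k => (d * ((2 : ℝ) ^ k)⁻¹) ^ v with hr
  have hr0 : ∀ k, 0 ≤ r k := fun k => by positivity
  have hcost : ∀ k ≤ K, ∀ i j, dyadicCell d K k i = dyadicCell d K k j →
      ∀ x ∈ binSet d (2 ^ K) i, ∀ y ∈ binSet d (2 ^ K) j, lpDist p x y ^ v ≤ r k :=
    fun k hk i j h x hx y hy => Real.rpow_le_rpow (lpDist_nonneg _ _ _)
      (lpDist_le_of_abs_sub_le hp hd (by positivity)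
        fun l => abs_sub_le_of_dyadicCell_eq hk h hx hy l) hv.le
  set S : (Fin d → Fin (2 ^ K)) → (Fin d → Fin (2 ^ K)) → Set ℝ := fun i j =>
    {u | ∃ x ∈ binSet d (2 ^ K) i, ∃ y ∈ binSet d (2 ^ K) j, u = lpDist p x y ^ v} with hS
  have hD : ∀ k ≤ K, ∀ i j, dyadicCell d K k i = dyadicCell d K k j → sSup (S i j) ≤ r k := by
    intro k hk i j h
    refine Real.sSup_le ?_ (hr0 k)
    rintro _ ⟨x, hx, y, hy, rfl⟩
    exact hcost k hk i j h x hx y hy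
  obtain ⟨w, hwn, hwa, hwb, hwc⟩ := exists_multiscale_plan (dyadicCell d K)
    dyadicCell_refines dyadicCell_zero (fun i j => sSup (S i j)) r hr0 K hD
    (fun i => P.real (binSet d (2 ^ K) i)) (postWeight d (2 ^ K) α Y)
    (fun _ => measureReal_nonneg) hw0 (by rw [hsumP, hw1])
  refine (wassersteinLp_le_of_plan p v hv P _ (binSet d (2 ^ K))
    (measurableSet_binSet d _) (pairwise_disjoint_binSet d _) hPae
    (ae_mem_binSet_histMeasure _) (fun i j => sSup (S i j)) ?_ ?_ w hwn hwa ?_).trans ?_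
  · intro i j
    refine Real.sSup_nonneg ?_
    rintro _ ⟨x, _, y, _, rfl⟩
    exact Real.rpow_nonneg (lpDist_nonneg _ _ _) _
  · intro i j x hx y hy
    refine le_csSup ⟨r 0, ?_⟩ ⟨x, hx, y, hy, rfl⟩
    rintro _ ⟨x, hx, y, hy, rfl⟩
    exact hcost 0 (Nat.zero_le _) i j (dyadicCell_zero i j) x hx y hy
  · intro j
    rw [hwb, measureReal_def, histMeasure_binSet hb, ENNReal.toReal_ofReal (hw0 j)]
  · refine Real.rpow_le_rpow (Finset.sum_nonneg fun i _ => Finset.sum_nonneg fun j _ =>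
      mul_nonneg (hwn i j) (Real.sSup_nonneg ?_)) (hwc.trans ?_) (by positivity)
    · rintro _ ⟨x, _, y, _, rfl⟩
      exact Real.rpow_nonneg (lpDist_nonneg _ _ _) _
    · rw [hsumP, mul_one]
      refine add_le_add le_rfl (Finset.sum_le_sum fun k _ =>
        mul_le_mul_of_nonneg_left ?_ (hr0 k))
      have hF1 := sum_measureReal_dyadicSet_le P K (k + 1)
      have hterm : ∀ c, max 0 (∑ i with dyadicCell d K (k + 1) i = c,
          (P.real (binSet d (2 ^ K) i) - postWeight d (2 ^ K) α Y i)) ≤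
          s / n * P.real (dyadicSet d K (k + 1) c) + |P.real (dyadicSet d K (k + 1) c) -
            (∑ t, (dyadicSet d K (k + 1) c).indicator (1 : (Fin d → ℝ) → ℝ) (Y t)) / n| := by
        intro c
        have hF : 0 ≤ P.real (dyadicSet d K (k + 1) c) := measureReal_nonneg
        refine max_le (by positivity) ?_
        simp only [postWeight]
        rw [Finset.sum_sub_distrib, ← measureReal_dyadicSet, ← Finset.sum_div,
          Finset.sum_add_distrib, sum_binCount_dyadicCell]
        have hαc : 0 ≤ ∑ i with dyadicCell d K (k + 1) i = c, α i :=
          Finset.sum_nonneg fun i _ => hα i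
        generalize (∑ t, (dyadicSet d K (k + 1) c).indicator (1 : (Fin d → ℝ) → ℝ) (Y t)) = N
        generalize (∑ i with dyadicCell d K (k + 1) i = c, α i) = a at hαc
        generalize P.real (dyadicSet d K (k + 1) c) = F at hF
        rw [← hs]
        have h1 : F - (a + N) / (n + s)
            = (n / (n + s)) * (F - N / n) + s / (n + s) * F - a / (n + s) := by
          field_simp
          ring
        have h2 : (n / (n + s)) * (F - N / n) ≤ |F - N / n| := by
          calc (n / (n + s)) * (F - N / n) ≤ (n / (n + s)) * |F - N / n| :=
                mul_le_mul_of_nonneg_left (le_abs_self _) (by positivity)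
            _ ≤ |F - N / n| := mul_le_of_le_one_left (abs_nonneg _)
                (div_le_one_of_le₀ (by linarith) hns.le)
        have h3 : s / (n + s) * F ≤ s / n * F :=
          mul_le_mul_of_nonneg_right
            (div_le_div_of_nonneg_left hs0 hn' (by linarith)) hF
        have h4 : 0 ≤ a / (n + s) := by positivity
        linarith
      refine (Finset.sum_le_sum fun c _ => hterm c).trans ?_
      rw [Finset.sum_add_distrib, ← Finset.mul_sum]
      exact add_le_add (mul_le_of_le_one_right (by positivity) hF1) le_rfl

lemma rpow_le_two_pow_KSeq {d : ℕ} {v : ℝ} (hdv : (d : ℝ) > 2 * v) {n : ℕ} (hn : 0 < n) :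
    (n : ℝ) ^ (1 / (d : ℝ)) ≤ 2 ^ KSeq d v n := by
  have hn' : (0 : ℝ) < n := by exact_mod_cast hn
  rw [KSeq, kSeq, if_neg (not_le.mpr hdv)]
  have hx : (0 : ℝ) < (n : ℝ) ^ (1 / (d : ℝ)) := by positivity
  conv_lhs => rw [← Real.rpow_logb (b := 2) two_pos (by norm_num) hx]
  rw [← Real.rpow_natCast]
  exact Real.rpow_le_rpow_of_exponent_le one_le_two (Nat.le_ceil _)

lemma two_pow_KSeq_le {d : ℕ} {v : ℝ} (hdv : (d : ℝ) > 2 * v) {n : ℕ} (hn : 0 < n) :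
    (2 : ℝ) ^ KSeq d v n ≤ 2 * (n : ℝ) ^ (1 / (d : ℝ)) := by
  have hn' : (1 : ℝ) ≤ n := by exact_mod_cast hn
  rw [KSeq, kSeq, if_neg (not_le.mpr hdv)]
  have hx : (1 : ℝ) ≤ (n : ℝ) ^ (1 / (d : ℝ)) := Real.one_le_rpow hn' (by positivity)
  have hx0 : (0 : ℝ) < (n : ℝ) ^ (1 / (d : ℝ)) := by linarith
  have hlog : 0 ≤ Real.logb 2 ((n : ℝ) ^ (1 / (d : ℝ))) :=
    Real.logb_nonneg one_lt_two hx
  calc (2 : ℝ) ^ ⌈Real.logb 2 ((n : ℝ) ^ (1 / (d : ℝ)))⌉₊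
      ≤ 2 ^ (Real.logb 2 ((n : ℝ) ^ (1 / (d : ℝ))) + 1) := by
        rw [← Real.rpow_natCast]
        exact Real.rpow_le_rpow_of_exponent_le one_le_two (Nat.ceil_lt_add_one hlog).le
    _ = 2 * (n : ℝ) ^ (1 / (d : ℝ)) := by
        rw [Real.rpow_add two_pos, Real.rpow_logb two_pos (by norm_num) hx0, Real.rpow_one,
          mul_comm]

lemma scale_rpow_eq (d : ℕ) (v : ℝ) (k : ℕ) :
    ((d : ℝ) * ((2 : ℝ) ^ k)⁻¹) ^ v = (d : ℝ) ^ v * ((2 : ℝ) ^ (-v)) ^ k := by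
  rw [Real.mul_rpow (by positivity) (by positivity), ← Real.rpow_natCast, ← Real.rpow_neg two_pos.le,
    ← Real.rpow_mul two_pos.le, ← Real.rpow_natCast, ← Real.rpow_mul two_pos.le]
  ring_nf

lemma two_rpow_pow_comm (s : ℝ) (k : ℕ) : ((2 : ℝ) ^ s) ^ k = ((2 : ℝ) ^ k) ^ s := by
  rw [← Real.rpow_natCast, ← Real.rpow_mul two_pos.le, mul_comm, Real.rpow_mul two_pos.le,
    Real.rpow_natCast]

/-- At the resolution `KSeq` the total multiscale error is of order `n ^ (-(v / d))`. -/
lemma exists_multiscale_error_le {d : ℕ} {v c : ℝ} (hv : 1 ≤ v) (hdv : (d : ℝ) > 2 * v)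
    (hc : 0 < c) : ∃ C > (0 : ℝ), ∀ n : ℕ, 0 < n → ∀ s ≤ c * (n : ℝ) ^ (1 - v / d),
      (d * ((2 : ℝ) ^ KSeq d v n)⁻¹) ^ v + ∑ k ∈ Finset.range (KSeq d v n),
        (d * ((2 : ℝ) ^ k)⁻¹) ^ v * (s / n + √((2 ^ (k + 1)) ^ d / n))
        ≤ C * (n : ℝ) ^ (-(v / d)) := by
  have hd0 : (0 : ℝ) < d := by linarith
  set θ : ℝ := 2 ^ ((d : ℝ) / 2 - v) with hθ
  have hθ1 : 1 < θ := Real.one_lt_rpow one_lt_two (by linarith)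
  set ρ : ℝ := 2 ^ (-v) with hρ
  have hρ0 : 0 < ρ := by positivity
  have hρ1 : ρ ≤ 1 / 2 := by
    calc ρ ≤ 2 ^ (-1 : ℝ) := Real.rpow_le_rpow_of_exponent_le one_le_two (by linarith)
      _ = 1 / 2 := by rw [Real.rpow_neg_one]; norm_num
  refine ⟨(d : ℝ) ^ v * (1 + 2 * c + 2 ^ ((d : ℝ) / 2) * (θ / (θ - 1))), ?_, ?_⟩
  · have : 0 < θ - 1 := by linarith
    positivity
  intro n hn s hs
  have hn' : (0 : ℝ) < n := by exact_mod_cast hn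
  set K := KSeq d v n
  set T := (n : ℝ) ^ (-(v / d)) with hT
  have hT0 : 0 < T := by positivity
  have hfirst : ρ ^ K ≤ T := by
    have h1 : T = ((n : ℝ) ^ (1 / (d : ℝ))) ^ (-v) := by
      rw [hT, ← Real.rpow_mul hn'.le]
      ring_nf
    rw [hρ, two_rpow_pow_comm, h1]
    exact Real.rpow_le_rpow_of_nonpos (by positivity) (rpow_le_two_pow_KSeq hdv hn) (by linarith)
  have hprior : s / n ≤ c * T := by
    rw [div_le_iff₀ hn']
    refine hs.trans (le_of_eq ?_)
    rw [mul_assoc, hT]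
    congr 1
    rw [sub_eq_neg_add, Real.rpow_add hn', Real.rpow_one]
  have hgeom : ∑ k ∈ Finset.range K, ρ ^ k ≤ 2 := by
    rw [geom_sum_eq (by linarith), ← neg_div_neg_eq, div_le_iff₀ (by linarith)]
    have : 0 < ρ ^ K := by positivity
    linarith
  have hθK : θ ^ K ≤ θ * (n : ℝ) ^ (1 / 2 - v / d) := by
    rw [hθ, two_rpow_pow_comm]
    calc ((2 : ℝ) ^ K) ^ ((d : ℝ) / 2 - v)
        ≤ (2 * (n : ℝ) ^ (1 / (d : ℝ))) ^ ((d : ℝ) / 2 - v) :=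
          Real.rpow_le_rpow (by positivity) (two_pow_KSeq_le hdv hn) (by linarith)
      _ = _ := by
          rw [Real.mul_rpow two_pos.le (by positivity), ← Real.rpow_mul hn'.le]
          congr 2
          field_simp
  have hgeomθ : ∑ k ∈ Finset.range K, θ ^ k ≤ θ / (θ - 1) * (n : ℝ) ^ (1 / 2 - v / d) := by
    rw [geom_sum_eq hθ1.ne', div_mul_eq_mul_div]
    exact div_le_div_of_nonneg_right (by linarith) (by linarith)
  have hsqrt : ∀ k : ℕ, ρ ^ k * √((2 ^ (k + 1)) ^ d / n)
      = 2 ^ ((d : ℝ) / 2) * (n : ℝ) ^ (-(1 / 2 : ℝ)) * θ ^ k := by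
    intro k
    have h1 : √(((2 : ℝ) ^ (k + 1)) ^ d) = 2 ^ ((d : ℝ) / 2) * (2 ^ ((d : ℝ) / 2)) ^ k := by
      rw [← pow_succ', two_rpow_pow_comm, Real.sqrt_eq_rpow, ← Real.rpow_natCast _ d,
        ← Real.rpow_mul (by positivity)]
      ring_nf
    have h2 : θ = ρ * 2 ^ ((d : ℝ) / 2) := by
      rw [hθ, hρ, ← Real.rpow_add two_pos]
      ring_nf
    rw [Real.sqrt_div (by positivity), h1, h2, mul_pow, Real.rpow_neg hn'.le,
      ← Real.sqrt_eq_rpow]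
    ring
  have hhalf : (n : ℝ) ^ (-(1 / 2 : ℝ)) * (n : ℝ) ^ (1 / 2 - v / d) = T := by
    rw [← Real.rpow_add hn', hT]
    ring_nf
  have hρs : ∑ k ∈ Finset.range K, ρ ^ k * (s / n) ≤ 2 * (c * T) := by
    rw [← Finset.sum_mul]
    exact (mul_le_mul_of_nonneg_left hprior (Finset.sum_nonneg fun _ _ => by positivity)).trans
      (mul_le_mul_of_nonneg_right hgeom (by positivity))
  have hρsq : ∑ k ∈ Finset.range K, ρ ^ k * √((2 ^ (k + 1)) ^ d / n)
      ≤ 2 ^ ((d : ℝ) / 2) * (θ / (θ - 1)) * T := by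
    simp only [hsqrt]
    rw [← Finset.mul_sum]
    calc _ ≤ 2 ^ ((d : ℝ) / 2) * (n : ℝ) ^ (-(1 / 2 : ℝ)) *
          (θ / (θ - 1) * (n : ℝ) ^ (1 / 2 - v / d)) :=
          mul_le_mul_of_nonneg_left hgeomθ (by positivity)
      _ = 2 ^ ((d : ℝ) / 2) * (θ / (θ - 1)) *
          ((n : ℝ) ^ (-(1 / 2 : ℝ)) * (n : ℝ) ^ (1 / 2 - v / d)) := by ring
      _ = _ := by rw [hhalf]
  have hdv0 : 0 < (d : ℝ) ^ v := by positivity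
  simp only [scale_rpow_eq, mul_assoc, ← Finset.mul_sum]
  rw [← mul_add]
  refine mul_le_mul_of_nonneg_left ?_ hdv0.le
  simp only [mul_add, Finset.sum_add_distrib]
  linarith

/-- Young-type replacement of a concave power by an affine function. -/
lemma rpow_one_div_le_affine {v g T : ℝ} (hv : 1 ≤ v) (hg : 0 ≤ g) (hT : 0 < T) :
    g ^ (1 / v) ≤ T ^ (1 / v) * (1 + g / T) := by
  have hgT : 0 ≤ g / T := by positivity
  have h1 : g ^ (1 / v) = T ^ (1 / v) * (g / T) ^ (1 / v) := by
    rw [← Real.mul_rpow hT.le hgT, mul_div_cancel₀ _ hT.ne']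
  rw [h1]
  refine mul_le_mul_of_nonneg_left ?_ (by positivity)
  calc (g / T) ^ (1 / v) ≤ (1 + g / T) ^ (1 / v) :=
        Real.rpow_le_rpow hgT (by linarith) (by positivity)
    _ ≤ (1 + g / T) ^ (1 : ℝ) := Real.rpow_le_rpow_of_exponent_le (by linarith)
        (by rw [div_le_one (by linarith)]; exact hv)
    _ = 1 + g / T := Real.rpow_one _

lemma sum_sq_div_add_div_two_le {κ : Type*} (s : Finset κ) (F E : κ → ℝ) {n M : ℝ}
    (hn : 0 < n) (hM : 0 < M) (hs : (s.card : ℝ) ≤ M) (hE : ∀ c ∈ s, E c ≤ F c / n)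
    (hF : ∑ c ∈ s, F c ≤ 1) :
    ∑ c ∈ s, (E c / (√(M / n) / M) + √(M / n) / M) / 2 ≤ √(M / n) := by
  set β := √(M / n) with hβ
  have hβ0 : 0 < β := Real.sqrt_pos.mpr (by positivity)
  have hβ2 : β * β = M / n := Real.mul_self_sqrt (by positivity)
  rw [← Finset.sum_div, Finset.sum_add_distrib, Finset.sum_const, nsmul_eq_mul,
    ← Finset.sum_div]
  have h1 : (∑ c ∈ s, E c) / (β / M) ≤ β := by
    rw [div_le_iff₀ (by positivity)]
    calc ∑ c ∈ s, E c ≤ ∑ c ∈ s, F c / n := Finset.sum_le_sum hE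
      _ ≤ 1 / n := by
          rw [← Finset.sum_div]
          exact div_le_div_of_nonneg_right hF hn.le
      _ = β * (β / M) := by
          rw [← mul_div_assoc, hβ2]
          field_simp
  have h2 : s.card * (β / M) ≤ β := by
    calc s.card * (β / M) ≤ M * (β / M) := mul_le_mul_of_nonneg_right hs (by positivity)
      _ = β := mul_div_cancel₀ _ hM.ne'
  linarith

/-- For d > 2v, under the prior-mass bound Σ_j α_{j,b_n} ≤ c·n^{1−v/d}, the posterior
mean histogram attains the rate n^{-1/d} in expected Wasserstein-v loss, uniformly over Borel
probability measures P₀ on [0,1)^d. -/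
theorem bayes_histogram_rate_d_gt_2v
    (d : ℕ) (hd : 1 ≤ d) (p v : ℝ) (hp : 1 ≤ p) (hv : 1 ≤ v) (hdv : (d : ℝ) > 2 * v)
    (α : ∀ n : ℕ, (Fin d → Fin (bSeq d v n)) → ℝ) (c : ℝ) (hc : 0 < c)
    (hα0 : ∀ n j, 0 ≤ α n j)
    (hαsum : ∀ n : ℕ, ∑ j, α n j ≤ c * (n : ℝ) ^ (1 - v / d)) :
    ∃ C > (0 : ℝ), ∃ N : ℕ, ∀ n ≥ N, ∀ P₀ : Measure (Fin d → ℝ),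
      IsProbabilityMeasure P₀ → P₀ (cube d) = 1 →
      ∫ Y, wassersteinLp p v P₀ (postMeanHist d v (α n) Y)
          ∂(Measure.pi fun _ : Fin n => P₀)
        ≤ C * (n : ℝ) ^ (-(1 / (d : ℝ))) := by
  obtain ⟨C, hC0, hC⟩ := exists_multiscale_error_le hv hdv hc
  refine ⟨1 + C, by linarith, 1, fun n hn P₀ hP hcube => ?_⟩
  have hv0 : 0 < v := by linarith
  have hn0 : 0 < n := hn
  have hn' : (0 : ℝ) < n := by exact_mod_cast hn0
  set K := KSeq d v n with hK
  set T : ℝ := (n : ℝ) ^ (-(v / d)) with hT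
  have hT0 : 0 < T := by positivity
  have hTv : T ^ (1 / v) = (n : ℝ) ^ (-(1 / (d : ℝ))) := by
    rw [hT, ← Real.rpow_mul hn'.le]
    congr 1
    field_simp
  set s := ∑ j, α n j with hs
  have hs0 : 0 ≤ s := Finset.sum_nonneg fun j _ => hα0 n j
  set r : ℕ → ℝ := fun k => ((d : ℝ) * ((2 : ℝ) ^ k)⁻¹) ^ v with hr
  have hr0 : ∀ k, 0 ≤ r k := fun k => by positivity
  set I : ℕ → Finset (Fin d → ℕ) := fun k => Finset.univ.image (dyadicCell d K (k + 1)) with hI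
  set F : ℕ → (Fin d → ℕ) → ℝ := fun k c => P₀.real (dyadicSet d K (k + 1) c) with hF
  set Z : ℕ → (Fin d → ℕ) → (Fin n → Fin d → ℝ) → ℝ := fun k c Y => F k c -
    (∑ t, (dyadicSet d K (k + 1) c).indicator (1 : (Fin d → ℝ) → ℝ) (Y t)) / n with hZ
  set M : ℕ → ℝ := fun k => (2 ^ (k + 1)) ^ d with hM
  have hM0 : ∀ k, 0 < M k := fun k => by positivity
  set l : ℕ → ℝ := fun k => √(M k / n) / M k with hl
  have hl0 : ∀ k, 0 < l k := fun k =>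
    div_pos (Real.sqrt_pos.mpr (div_pos (hM0 k) hn')) (hM0 k)
  set H : (Fin n → Fin d → ℝ) → ℝ := fun Y => r K + ∑ k ∈ Finset.range K, r k *
    (s / n + ∑ c ∈ I k, (Z k c Y ^ 2 / l k + l k) / 2) with hH
  have hZint : ∀ k c, Integrable (fun Y => Z k c Y ^ 2) (Measure.pi fun _ : Fin n => P₀) :=
    fun k c => (integral_sq_sub_frequency_le P₀ hn0 (measurableSet_dyadicSet d K (k + 1) c)).1
  have hZle : ∀ k c, ∫ Y, Z k c Y ^ 2 ∂(Measure.pi fun _ : Fin n => P₀) ≤ F k c / n :=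
    fun k c => (integral_sq_sub_frequency_le P₀ hn0 (measurableSet_dyadicSet d K (k + 1) c)).2
  have hterm : ∀ k c, Integrable (fun Y => (Z k c Y ^ 2 / l k + l k) / 2)
      (Measure.pi fun _ : Fin n => P₀) := fun k c =>
    (((hZint k c).div_const _).add (integrable_const _)).div_const _
  have hscale : ∀ k, Integrable (fun Y => r k *
      (s / n + ∑ c ∈ I k, (Z k c Y ^ 2 / l k + l k) / 2)) (Measure.pi fun _ : Fin n => P₀) :=
    fun k => ((integrable_const _).add (integrable_finsetSum _ fun c _ => hterm k c)).const_mul _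
  have hHint : Integrable H (Measure.pi fun _ : Fin n => P₀) :=
    (integrable_const _).add (integrable_finsetSum _ fun k _ => hscale k)
  have hHle : ∫ Y, H Y ∂(Measure.pi fun _ : Fin n => P₀) ≤ C * T := by
    refine le_trans ?_ (hC n hn0 s (hαsum n))
    rw [hH, integral_add (integrable_const _) (integrable_finsetSum _ fun k _ => hscale k),
      integral_finsetSum _ fun k _ => hscale k]
    refine add_le_add (by simp [hr, hK]) (Finset.sum_le_sum fun k hk => ?_)
    rw [integral_const_mul, integral_add (integrable_const _)
      (integrable_finsetSum _ fun c _ => hterm k c), integral_finsetSum _ fun c _ => hterm k c]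
    refine mul_le_mul_of_nonneg_left (add_le_add (by simp) ?_) (hr0 k)
    have hE : ∀ c, ∫ Y, (Z k c Y ^ 2 / l k + l k) / 2 ∂(Measure.pi fun _ : Fin n => P₀)
        = ((∫ Y, Z k c Y ^ 2 ∂(Measure.pi fun _ : Fin n => P₀)) / l k + l k) / 2 := by
      intro c
      rw [integral_div, integral_add ((hZint k c).div_const _) (integrable_const _),
        integral_div]
      simp
    simp only [hE]
    refine sum_sq_div_add_div_two_le (I k) (F k) _ hn' (hM0 k) ?_ (fun c _ => hZle k c) ?_
    · have := card_image_dyadicCell (d := d) (K := K) (k := k + 1) (Finset.mem_range.mp hk)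
      simp only [hI, hM]
      exact_mod_cast this
    · exact sum_measureReal_dyadicSet_le P₀ K (k + 1)
  have hcube_ae : ∀ᵐ Y ∂(Measure.pi fun _ : Fin n => P₀), ∀ t, Y t ∈ cube d := by
    rw [ae_all_iff]
    exact fun t => (measurePreserving_eval (fun _ : Fin n => P₀) t).quasiMeasurePreserving.ae
      ((mem_ae_iff_prob_eq_one (measurableSet_cube d)).mpr hcube)
  have hbound : ∀ᵐ Y ∂(Measure.pi fun _ : Fin n => P₀),
      wassersteinLp p v P₀ (postMeanHist d v (α n) Y) ≤ T ^ (1 / v) * (1 + H Y / T) := by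
    filter_upwards [hcube_ae] with Y hY
    refine (wassersteinLp_postWeight_le hd hp hv0 K hn0 (α n) (hα0 n) P₀ hcube Y hY).trans ?_
    have hsn : 0 ≤ s / n := by positivity
    have hnn : 0 ≤ r K + ∑ k ∈ Finset.range K, r k * (s / n + ∑ c ∈ I k, |Z k c Y|) :=
      add_nonneg (hr0 K) (Finset.sum_nonneg fun k _ => mul_nonneg (hr0 k)
        (add_nonneg hsn (Finset.sum_nonneg fun c _ => abs_nonneg _)))
    have hle : r K + ∑ k ∈ Finset.range K, r k * (s / n + ∑ c ∈ I k, |Z k c Y|) ≤ H Y := by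
      refine add_le_add le_rfl (Finset.sum_le_sum fun k _ => mul_le_mul_of_nonneg_left
        (add_le_add le_rfl (Finset.sum_le_sum fun c _ => ?_)) (hr0 k))
      have h1 : Z k c Y ^ 2 / l k + l k - 2 * |Z k c Y| = (|Z k c Y| - l k) ^ 2 / l k := by
        have := (hl0 k).ne'
        field_simp
        rw [← sq_abs (Z k c Y)]
        ring
      have h2 : 0 ≤ (|Z k c Y| - l k) ^ 2 / l k := div_nonneg (sq_nonneg _) (hl0 k).le
      linarith
    exact (Real.rpow_le_rpow hnn hle (by positivity)).trans
      (rpow_one_div_le_affine hv (hnn.trans hle) hT0)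
  have hint : Integrable (fun Y => T ^ (1 / v) * (1 + H Y / T))
      (Measure.pi fun _ : Fin n => P₀) :=
    ((integrable_const _).add (hHint.div_const _)).const_mul _
  refine (integral_mono_of_nonneg
    (Eventually.of_forall fun Y => wassersteinLp_nonneg _ _ _ _) hint hbound).trans ?_
  rw [integral_const_mul, integral_add (integrable_const _) (hHint.div_const _), integral_div,
    hTv, mul_comm]
  refine mul_le_mul_of_nonneg_right (add_le_add (by simp) ?_) (by positivity)
  rw [div_le_iff₀ hT0]
  exact hHle

end
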